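/- Let C be a nontrivial linear [n,k,d]_q code. Then C is completely regular with covering radius ρ = 1 if and only if there exist integers m ≥ 2, ℓ ≥ 1 and u ≥ 0 with n = ℓ·(q^m−1)/(q−1) + u and k = n − m such that C is monomially equivalent to the code {(x_1|⋯|x_ℓ|y) ∈ 𝔽_q^n : x_i ∈ 𝔽_q^{n_m}, x_1+⋯+x_ℓ ∈ ℋ, y ∈ 𝔽_q^u}, where ℋ is a q-ary Hamming code of length n_m = (q^m−1)/(q−1). -/

import Mathlib

open Finset

variable {F : Type*} [Field F] [Fintype F] [DecidableEq F]

/-- The Hamming distance from a vector to a code. -/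
noncomputable def distToCode {ι : Type*} [Fintype ι] (C : Set (ι → F)) (x : ι → F) : ℕ :=
  sInf {d : ℕ | ∃ c ∈ C, hammingDist x c = d}

/-- The covering radius of a code: the maximal distance of a vector to the code. -/
noncomputable def coveringRadius {ι : Type*} [Fintype ι] (C : Set (ι → F)) : ℕ :=
  sSup {d : ℕ | ∃ x : ι → F, distToCode C x = d}

/-- `C` has intersection numbers `b l` (number of neighbours one step further from the code)
and `c l` (number of neighbours one step closer to the code), for every `x` at distance `l`. -/
def HasIntersectionNumbers {ι : Type*} [Fintype ι] (C : Set (ι → F)) (b c : ℕ → ℕ) : Prop :=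
  ∀ l : ℕ, ∀ x : ι → F, distToCode C x = l →
    Nat.card {y : ι → F | hammingDist x y = 1 ∧ distToCode C y = l + 1} = b l ∧
    Nat.card {y : ι → F | hammingDist x y = 1 ∧ distToCode C y + 1 = l} = c l

/-- A code is completely regular if it admits intersection numbers. -/
def IsCompletelyRegular {ι : Type*} [Fintype ι] (C : Set (ι → F)) : Prop :=
  ∃ b c : ℕ → ℕ, HasIntersectionNumbers C b c

/-- The minimum distance of a code. -/
noncomputable def minDist {ι : Type*} [Fintype ι] (C : Set (ι → F)) : ℕ :=
  sInf {d : ℕ | ∃ x ∈ C, ∃ y ∈ C, x ≠ y ∧ hammingDist x y = d}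

/-- A code is equidistant if any two distinct codewords are at the same Hamming distance. -/
def IsEquidistant {ι : Type*} [Fintype ι] (C : Set (ι → F)) : Prop :=
  ∃ d : ℕ, ∀ x ∈ C, ∀ y ∈ C, x ≠ y → hammingDist x y = d

/-- The dual of a code, with respect to the standard bilinear form. -/
def dualSet {ι : Type*} [Fintype ι] (C : Set (ι → F)) : Set (ι → F) :=
  {y | ∀ x ∈ C, ∑ i, x i * y i = 0}

/-- A code of length `n` is antipodal if it contains a word of Hamming weight `n`. -/
def IsAntipodal {ι : Type*} [Fintype ι] (C : Set (ι → F)) : Prop :=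
  ∃ v ∈ C, hammingNorm v = Fintype.card ι

/-- A monomial transformation: a coordinate permutation composed with multiplication of
each coordinate by a nonzero scalar. -/
def IsMonomialMap {ι : Type*} (φ : (ι → F) → (ι → F)) : Prop :=
  ∃ (π : Equiv.Perm ι) (s : ι → Fˣ), ∀ x i, φ x i = (s i : F) * x (π i)

/-- Two codes are monomially equivalent if one is the image of the other under a bijection of
coordinates together with multiplication of each coordinate by a nonzero scalar. -/
def MonomiallyEquivalent {ι κ : Type*} (C : Set (ι → F)) (D : Set (κ → F)) : Prop :=
  ∃ (e : ι ≃ κ) (s : ι → Fˣ),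
    (fun (x : ι → F) (j : κ) => (s (e.symm j) : F) * x (e.symm j)) '' C = D

/-- The orbit, under the action of `Aut C` on the cosets of `C`, of the coset of `v`
(realised as the union of all cosets in the orbit). -/
def cosetOrbit {ι : Type*} (C : Submodule F (ι → F)) (v : ι → F) : Set (ι → F) :=
  {w | ∃ φ : (ι → F) → (ι → F), IsMonomialMap φ ∧
    φ '' (C : Set (ι → F)) = (C : Set (ι → F)) ∧ φ v - w ∈ C}

/-- The number of orbits of the action of `Aut C` on the cosets of `C`. -/
noncomputable def numCosetOrbits {ι : Type*} (C : Submodule F (ι → F)) : ℕ :=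
  Nat.card (Set.range (cosetOrbit C))

/-- `H` is a `q`-ary Hamming code with parameter `m ≥ 2`: a perfect
`[(q^m-1)/(q-1), (q^m-1)/(q-1) - m, 3]_q` code with covering radius 1. -/
def IsHammingCode (m : ℕ) {nm : ℕ} (H : Submodule F (Fin nm → F)) : Prop :=
  2 ≤ m ∧ nm = (Fintype.card F ^ m - 1) / (Fintype.card F - 1) ∧
  Module.finrank F H = nm - m ∧ minDist (H : Set (Fin nm → F)) = 3 ∧
  coveringRadius (H : Set (Fin nm → F)) = 1

/-- The extended code: append an overall parity-check coordinate. -/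
def extendedCode {m : ℕ} (D : Set (Fin m → F)) : Set (Fin (m + 1) → F) :=
  {z | (fun i : Fin m => z i.castSucc) ∈ D ∧ ∑ i, z i = 0}

/-- Construction I(u): append `u` free coordinates to every codeword. -/
def appendCode (u : ℕ) {n : ℕ} (C : Set (Fin n → F)) : Set (Fin (n + u) → F) :=
  {z | ∃ c ∈ C, ∃ y : Fin u → F, z = Fin.append c y}

/-- Construction II(ℓ): codewords are `ℓ`-tuples of blocks whose `λ`-weighted sum lies in `C`. -/
def repeatCode {n ℓ : ℕ} (lam : Fin ℓ → Fˣ) (C : Set (Fin n → F)) :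
    Set (Fin ℓ × Fin n → F) :=
  {z | (fun j : Fin n => ∑ i : Fin ℓ, (lam i : F) * z (i, j)) ∈ C}

/-- The code `{(x₁|⋯|x_ℓ|y) : x₁+⋯+x_ℓ ∈ H, y free}` built from a code `H`. -/
def hammingRepeatCode {nm : ℕ} (ℓ u : ℕ) (H : Set (Fin nm → F)) :
    Set ((Fin ℓ × Fin nm) ⊕ Fin u → F) :=
  {z | (fun j : Fin nm => ∑ i : Fin ℓ, z (Sum.inl (i, j))) ∈ H}

section CosetLines

omit [Fintype F]

variable {ι : Type*} [Fintype ι]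

omit [Field F] in
theorem distToCode_le_hammingDist {C : Set (ι → F)} (x : ι → F) {c : ι → F} (hc : c ∈ C) :
    distToCode C x ≤ hammingDist x c :=
  Nat.sInf_le ⟨c, hc, rfl⟩

omit [Field F] in
theorem exists_hammingDist_eq_distToCode {C : Set (ι → F)} (hC : C.Nonempty) (x : ι → F) :
    ∃ c ∈ C, hammingDist x c = distToCode C x :=
  Nat.sInf_mem (s := {d : ℕ | ∃ c ∈ C, hammingDist x c = d})
    (hC.elim fun c hc => ⟨_, c, hc, rfl⟩)

omit [Field F] in
theorem distToCode_eq_zero_iff {C : Set (ι → F)} (hC : C.Nonempty) {x : ι → F} :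
    distToCode C x = 0 ↔ x ∈ C := by
  constructor
  · intro h
    obtain ⟨c, hc, hxc⟩ := exists_hammingDist_eq_distToCode hC x
    rw [h, hammingDist_eq_zero] at hxc
    exact hxc ▸ hc
  · intro h
    simpa using distToCode_le_hammingDist x h

omit [Field F] in
theorem distToCode_le_coveringRadius {C : Set (ι → F)} (hC : C.Nonempty) (x : ι → F) :
    distToCode C x ≤ coveringRadius C := by
  refine le_csSup ⟨Fintype.card ι, ?_⟩ ⟨x, rfl⟩
  rintro _ ⟨y, rfl⟩
  obtain ⟨c, -, h⟩ := exists_hammingDist_eq_distToCode hC y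
  exact h ▸ hammingDist_le_card_fintype

theorem hammingDist_eq_one_iff [DecidableEq ι] {x y : ι → F} :
    hammingDist x y = 1 ↔ ∃ i, ∃ a : F, a ≠ 0 ∧ y = x - Pi.single i a := by
  constructor
  · intro h
    obtain ⟨i, hi⟩ := Finset.card_eq_one.mp h
    have hmem (j : ι) : x j ≠ y j ↔ j = i := by
      rw [← Finset.mem_singleton, ← hi]
      simp
    refine ⟨i, x i - y i, sub_ne_zero.mpr ((hmem i).mpr rfl), ?_⟩
    ext j
    by_cases hj : j = i
    · subst hj
      simp
    · simpa [hj] using (not_not.mp (mt (hmem j).mp hj)).symm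
  · rintro ⟨i, a, ha, rfl⟩
    refine Finset.card_eq_one.mpr ⟨i, ?_⟩
    ext j
    by_cases hj : j = i
    · subst hj
      simpa [eq_comm (a := x j), sub_eq_self] using ha
    · simp [hj]

theorem coveringRadius_eq_one_iff_distToCode (C : Submodule F (ι → F)) :
    coveringRadius (C : Set (ι → F)) = 1 ↔
      C ≠ ⊤ ∧ ∀ x ∉ C, distToCode (C : Set (ι → F)) x = 1 := by
  have hC : (C : Set (ι → F)).Nonempty := ⟨0, C.zero_mem⟩
  have h0 (x : ι → F) : distToCode (C : Set (ι → F)) x = 0 ↔ x ∈ C := distToCode_eq_zero_iff hC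
  constructor
  · intro h
    refine ⟨?_, fun x hx => ?_⟩
    · rintro rfl
      have : coveringRadius ((⊤ : Submodule F (ι → F)) : Set (ι → F)) ≤ 0 := by
        refine csSup_le ⟨_, 0, rfl⟩ ?_
        rintro _ ⟨y, rfl⟩
        exact ((h0 y).mpr trivial).le
      omega
    · have h1 := distToCode_le_coveringRadius hC x
      have h2 := mt (h0 x).mp hx
      omega
  · rintro ⟨hne, h⟩
    refine le_antisymm (csSup_le ⟨_, 0, rfl⟩ ?_) ?_
    · rintro _ ⟨y, rfl⟩
      by_cases hy : y ∈ C
      · simp [(h0 y).mpr hy]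
      · exact (h y hy).le
    · obtain ⟨x, hx⟩ : ∃ x, x ∉ C := by
        by_contra! hall
        exact hne (Submodule.eq_top_iff'.mpr hall)
      exact h x hx ▸ distToCode_le_coveringRadius hC x

theorem distToCode_eq_one_iff [DecidableEq ι] (C : Submodule F (ι → F)) {x : ι → F} (hx : x ∉ C) :
    distToCode (C : Set (ι → F)) x = 1 ↔ ∃ i, ∃ a : F, x - Pi.single i a ∈ C := by
  have hC : (C : Set (ι → F)).Nonempty := ⟨0, C.zero_mem⟩
  constructor
  · intro h
    obtain ⟨c, hc, hxc⟩ := exists_hammingDist_eq_distToCode hC x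
    rw [h] at hxc
    obtain ⟨i, a, -, rfl⟩ := hammingDist_eq_one_iff.mp hxc
    exact ⟨i, a, hc⟩
  · rintro ⟨i, a, hia⟩
    have ha : a ≠ 0 := by
      rintro rfl
      simp [hx] at hia
    have h1 := distToCode_le_hammingDist (C := (C : Set (ι → F))) x hia
    rw [hammingDist_eq_one_iff.mpr ⟨i, a, ha, rfl⟩] at h1
    have h2 := mt (distToCode_eq_zero_iff hC).mp hx
    omega

/-- A vector outside `C` has as many neighbours in `C` as there are coordinates in which it can be
corrected to a codeword. -/
theorem card_neighbors_mem [DecidableEq ι] (C : Submodule F (ι → F)) {x : ι → F} (hx : x ∉ C) :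
    Nat.card {y : ι → F | hammingDist x y = 1 ∧ y ∈ C} =
      Nat.card {i : ι // ∃ a : F, x - Pi.single i a ∈ C} := by
  have hne {i : ι} {a : F} (h : x - Pi.single i a ∈ C) : a ≠ 0 := by
    rintro rfl
    simp [hx] at h
  symm
  refine Nat.card_congr (Equiv.ofBijective (fun i => ⟨x - Pi.single i.1 i.2.choose,
    hammingDist_eq_one_iff.mpr ⟨_, _, hne i.2.choose_spec, rfl⟩, i.2.choose_spec⟩) ⟨?_, ?_⟩)
  · intro i j hij
    have h := sub_right_injective (congrArg Subtype.val hij)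
    have hi := congrFun h i.1
    by_contra hcon
    rw [Pi.single_eq_same, Pi.single_eq_of_ne fun h => hcon (Subtype.ext h)] at hi
    exact hne i.2.choose_spec hi
  · rintro ⟨y, hxy, hy⟩
    obtain ⟨i, a, -, rfl⟩ := hammingDist_eq_one_iff.mp hxy
    have hex : ∃ b : F, x - Pi.single i b ∈ C := ⟨a, hy⟩
    refine ⟨⟨i, hex⟩, Subtype.ext ?_⟩
    change x - Pi.single i hex.choose = x - Pi.single i a
    have hb := hex.choose_spec
    generalize hex.choose = b at hb ⊢
    by_contra hcon
    have hab : a - b ≠ 0 := fun h => hcon (by rw [sub_eq_zero.mp h])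
    have hd : Pi.single i (a - b) ∈ C := by
      have := C.sub_mem hb hy
      rwa [sub_sub_sub_cancel_left, ← Pi.single_sub] at this
    have hs : Pi.single i a ∈ C := by
      have := C.smul_mem (a * (a - b)⁻¹) hd
      rwa [← Pi.single_smul, smul_eq_mul, inv_mul_cancel_right₀ hab] at this
    exact hx (by simpa using C.add_mem hy hs)

theorem completelyRegular_coveringRadius_one_iff [DecidableEq ι] (C : Submodule F (ι → F)) :
    (IsCompletelyRegular (C : Set (ι → F)) ∧ coveringRadius (C : Set (ι → F)) = 1) ↔
      C ≠ ⊤ ∧ ∃ ℓ : ℕ, 1 ≤ ℓ ∧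
        ∀ x ∉ C, Nat.card {i : ι // ∃ a : F, x - Pi.single i a ∈ C} = ℓ := by
  have hC : (C : Set (ι → F)).Nonempty := ⟨0, C.zero_mem⟩
  have h0 (x : ι → F) : distToCode (C : Set (ι → F)) x = 0 ↔ x ∈ C := distToCode_eq_zero_iff hC
  rw [coveringRadius_eq_one_iff_distToCode]
  constructor
  · rintro ⟨⟨b, c, hbc⟩, hne, h1⟩
    have hcard (x : ι → F) (hx : x ∉ C) :
        Nat.card {i : ι // ∃ a : F, x - Pi.single i a ∈ C} = c 1 := by
      rw [← card_neighbors_mem C hx, ← (hbc 1 x (h1 x hx)).2]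
      simp only [add_eq_right, h0]
    refine ⟨hne, c 1, ?_, hcard⟩
    obtain ⟨x, hx⟩ : ∃ x, x ∉ C := by
      by_contra! hall
      exact hne (Submodule.eq_top_iff'.mpr hall)
    obtain ⟨i, hi⟩ := (distToCode_eq_one_iff C hx).mp (h1 x hx)
    rw [← hcard x hx]
    have : Nonempty {i : ι // ∃ a : F, x - Pi.single i a ∈ C} := ⟨⟨i, hi⟩⟩
    exact Nat.card_pos
  · rintro ⟨hne, ℓ, hℓ, hcard⟩
    have h1 (x : ι → F) (hx : x ∉ C) : distToCode (C : Set (ι → F)) x = 1 := by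
      rw [distToCode_eq_one_iff C hx]
      have hpos : 0 < Nat.card {i : ι // ∃ a : F, x - Pi.single i a ∈ C} := by
        rw [hcard x hx]
        omega
      obtain ⟨⟨i, hi⟩⟩ := (Nat.card_pos_iff.mp hpos).1
      exact ⟨i, hi⟩
    have h1iff (x : ι → F) : distToCode (C : Set (ι → F)) x = 1 ↔ x ∉ C :=
      ⟨fun h hx => by simp [(h0 x).mpr hx] at h, h1 x⟩
    have hle (x : ι → F) : distToCode (C : Set (ι → F)) x ≤ 1 := by
      by_cases hx : x ∈ C
      · simp [(h0 x).mpr hx]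
      · exact (h1 x hx).le
    refine ⟨⟨fun l => if l = 0 then Nat.card {y : ι → F | hammingDist 0 y = 1 ∧ y ∉ C} else 0,
      fun l => if l = 1 then ℓ else 0, ?_⟩, hne, h1⟩
    rintro _ x rfl
    by_cases hx : x ∈ C
    · simp only [(h0 x).mpr hx, zero_add, h1iff, if_true, zero_ne_one, if_false]
      refine ⟨Nat.card_congr ((Equiv.subRight x).subtypeEquiv fun y => ?_), by simp⟩
      simp [hammingDist_eq_hammingNorm x, neg_add_eq_sub, C.sub_mem_iff_left hx]
    · have h2 (y : ι → F) : distToCode (C : Set (ι → F)) y ≠ 1 + 1 := by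
        have := hle y
        omega
      simp only [h1 x hx, h2, add_eq_right, h0, if_true, one_ne_zero, if_false]
      refine ⟨by simp, ?_⟩
      rw [← hcard x hx, ← card_neighbors_mem C hx]

theorem coveringRadius_eq_one_iff [DecidableEq ι] (C : Submodule F (ι → F)) :
    coveringRadius (C : Set (ι → F)) = 1 ↔
      C ≠ ⊤ ∧ ∀ x ∉ C, ∃ i, ∃ a : F, x - Pi.single i a ∈ C := by
  rw [coveringRadius_eq_one_iff_distToCode]
  exact and_congr_right fun _ => forall₂_congr fun x hx => distToCode_eq_one_iff C hx

theorem minDist_eq_iff (C : Submodule F (ι → F)) {d : ℕ} (hd : d ≠ 0) :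
    minDist (C : Set (ι → F)) = d ↔
      (∃ c ∈ C, hammingNorm c = d) ∧ ∀ c ∈ C, c ≠ 0 → d ≤ hammingNorm c := by
  have hset : {d : ℕ | ∃ x ∈ (C : Set (ι → F)), ∃ y ∈ (C : Set (ι → F)),
      x ≠ y ∧ hammingDist x y = d} = {d : ℕ | ∃ c ∈ C, c ≠ 0 ∧ hammingNorm c = d} := by
    ext d
    constructor
    · rintro ⟨x, hx, y, hy, hxy, rfl⟩
      exact ⟨-x + y, C.add_mem (C.neg_mem hx) hy, by simpa [neg_add_eq_zero] using hxy,
        (hammingDist_eq_hammingNorm x y).symm⟩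
    · rintro ⟨c, hc, hne, rfl⟩
      exact ⟨c, hc, 0, C.zero_mem, hne, hammingDist_zero_right c⟩
  rw [minDist, hset]
  constructor
  · rintro rfl
    obtain ⟨c, hc, -, h⟩ := Nat.sInf_mem (Nat.nonempty_of_pos_sInf (Nat.pos_of_ne_zero hd))
    exact ⟨⟨c, hc, h⟩, fun c hc hne => Nat.sInf_le ⟨c, hc, hne, rfl⟩⟩
  · rintro ⟨⟨c, hc, rfl⟩, h⟩
    refine le_antisymm (Nat.sInf_le ⟨c, hc, hammingNorm_ne_zero_iff.mp hd, rfl⟩)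
      (le_csInf ⟨_, c, hc, hammingNorm_ne_zero_iff.mp hd, rfl⟩ ?_)
    rintro _ ⟨y, hy, hne, rfl⟩
    exact h y hy hne

theorem hammingNorm_single_le_one [DecidableEq ι] (i : ι) (a : F) :
    hammingNorm (Pi.single i a : ι → F) ≤ 1 := by
  refine (Finset.card_le_card (t := {i}) fun j hj => ?_).trans_eq (Finset.card_singleton i)
  by_contra hji
  simp_all

/-- In a code of minimum distance three, the correction of a single error is unique. -/
theorem single_eq_single_of_minDist_eq_three [DecidableEq ι] {C : Submodule F (ι → F)}
    (hC : minDist (C : Set (ι → F)) = 3) {x : ι → F} {i j : ι} {a b : F}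
    (hi : x - Pi.single i a ∈ C) (hj : x - Pi.single j b ∈ C) :
    (Pi.single i a : ι → F) = Pi.single j b := by
  by_contra hne
  have hmem : -Pi.single i a + Pi.single j b ∈ C := by
    simpa [sub_eq_add_neg, add_comm] using C.sub_mem hi hj
  have h3 := ((minDist_eq_iff C three_ne_zero).mp hC).2 _ hmem (by rwa [ne_eq, neg_add_eq_zero])
  rw [← hammingDist_eq_hammingNorm] at h3
  have h2 := hammingDist_triangle (Pi.single i a : ι → F) 0 (Pi.single j b)
  rw [hammingDist_zero_right, hammingDist_zero_left] at h2
  have := hammingNorm_single_le_one i a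
  have := hammingNorm_single_le_one j b
  omega

end CosetLines

section HammingCodes

/-- If the vectors `r j` represent the points of the projective space of `V` bijectively, then the
code with parity checks `r` is a Hamming code. -/
theorem isHammingCode_ker_linearCombination {V : Type*} [AddCommGroup V] [Module F V] {m N : ℕ}
    (hm : 2 ≤ m) (hN : N = (Fintype.card F ^ m - 1) / (Fintype.card F - 1))
    (hV : Module.finrank F V = m) {r : Fin N → V} (hr : ∀ j, r j ≠ 0)
    (hspan : ∀ v : V, v ≠ 0 → ∃ j, ∃ a : F, v = a • r j)
    (hinj : ∀ i j, ∀ a : F, r i = a • r j → i = j) :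
    IsHammingCode m (Fintype.linearCombination F r).ker := by
  have : Module.Finite F V := Module.finite_of_finrank_pos (by omega)
  set g := Fintype.linearCombination F r with hg
  have hsingle (j : Fin N) (a : F) : g (Pi.single j a) = a • r j :=
    Fintype.linearCombination_apply_single F r j a
  have hker {c : Fin N → F} : c ∈ g.ker ↔ ∑ j, c j • r j = 0 := Iff.rfl
  have hsurj : LinearMap.range g = ⊤ := by
    rw [eq_top_iff]
    intro v _
    by_cases hv : v = 0
    · exact hv ▸ zero_mem _
    · obtain ⟨j, a, rfl⟩ := hspan v hv
      exact ⟨Pi.single j a, hsingle j a⟩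
  have : Nontrivial V := Module.nontrivial_of_finrank_pos (R := F) (by omega)
  refine ⟨hm, hN, ?_, ?_, ?_⟩
  · have h := g.finrank_range_add_finrank_ker
    rw [hsurj, finrank_top, hV, Module.finrank_fin_fun] at h
    omega
  · refine (minDist_eq_iff _ three_ne_zero).mpr ⟨?_, fun c hc hne => ?_⟩
    · obtain ⟨v, hv⟩ := exists_ne (0 : V)
      obtain ⟨w, hvw⟩ := exists_linearIndependent_pair_of_one_lt_finrank (R := F)
        (by omega : 1 < Module.finrank F V) hv
      rw [LinearIndependent.pair_iff] at hvw
      have hw : w ≠ 0 := fun h => by simpa using hvw 0 1 (by simp [h])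
      have hsum : v + w ≠ 0 := fun h => by simpa using hvw 1 1 (by simpa using h)
      obtain ⟨i, a, hia⟩ := hspan v hv
      obtain ⟨j, b, hjb⟩ := hspan w hw
      obtain ⟨k, c, hkc⟩ := hspan _ hsum
      have ha : a ≠ 0 := by rintro rfl; simp [hv] at hia
      have hb : b ≠ 0 := by rintro rfl; simp [hw] at hjb
      have hc : c ≠ 0 := by rintro rfl; simp [hsum] at hkc
      have hij : i ≠ j := by
        rintro rfl
        exact hb (hvw b (-a) (by rw [hia, hjb]; module)).1
      have hik : i ≠ k := by
        rintro rfl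
        exact ha (neg_eq_zero.mp
          (hvw (c - a) (-a) (by linear_combination (norm := module) c • hia - a • hkc)).2)
      have hjk : j ≠ k := by
        rintro rfl
        exact hb (neg_eq_zero.mp
          (hvw (-b) (c - b) (by linear_combination (norm := module) c • hjb - b • hkc)).1)
      refine ⟨Pi.single i a + Pi.single j b - Pi.single k c, ?_, ?_⟩
      · rw [LinearMap.mem_ker, map_sub, map_add, hsingle, hsingle, hsingle, ← hia, ← hjb, ← hkc,
          sub_self]
      · refine Finset.card_eq_three.mpr ⟨i, j, k, hij, hik, hjk, ?_⟩
        ext l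
        simp only [Finset.mem_filter, Finset.mem_univ, true_and, Finset.mem_insert,
          Finset.mem_singleton, Pi.sub_apply, Pi.add_apply, Pi.single_apply]
        grind
    · rw [hker] at hc
      obtain ⟨i, hi⟩ := Function.ne_iff.mp hne
      by_contra! hlt
      have h2 : ¬ 2 < hammingNorm c := by omega
      rw [hammingNorm, Finset.two_lt_card] at h2
      by_cases hj : ∃ j, j ≠ i ∧ c j ≠ 0
      · obtain ⟨j, hji, hj⟩ := hj
        rw [Fintype.sum_eq_add i j hji.symm] at hc
        · refine hji.symm (hinj i j (-(c i)⁻¹ * c j) ?_)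
          rw [mul_smul, neg_smul, ← smul_neg, ← eq_neg_of_add_eq_zero_left hc, smul_smul,
            inv_mul_cancel₀ hi, one_smul]
        · rintro k ⟨hki, hkj⟩
          by_contra hk
          refine h2 ⟨i, by simpa using hi, j, by simpa using hj, k, ?_, hji.symm, hki.symm,
            hkj.symm⟩
          simpa using fun h => hk (by simp [h])
      · push Not at hj
        rw [Fintype.sum_eq_single i fun j hji => by simp [hj j hji]] at hc
        exact (smul_ne_zero hi (hr i)) hc
  · refine (coveringRadius_eq_one_iff _).mpr ⟨fun htop => ?_, fun x hx => ?_⟩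
    · obtain ⟨v, hv⟩ := exists_ne (0 : V)
      obtain ⟨j, -⟩ := hspan v hv
      have : Pi.single j 1 ∈ g.ker := htop ▸ Submodule.mem_top
      rw [LinearMap.mem_ker, hsingle, one_smul] at this
      exact hr j this
    · obtain ⟨j, a, h⟩ := hspan (g x) hx
      exact ⟨j, a, by rw [LinearMap.mem_ker, map_sub, hsingle, ← h, sub_self]⟩

omit [DecidableEq F] in
/-- Over a finite field, the points of a projective space of dimension `m - 1` can be represented
by vectors indexed by `Fin ((q ^ m - 1) / (q - 1))`. -/
theorem exists_projective_representatives {V : Type*} [AddCommGroup V] [Module F V]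
    [Module.Finite F V] {m N : ℕ} (hN : N = (Fintype.card F ^ m - 1) / (Fintype.card F - 1))
    (hV : Module.finrank F V = m) :
    ∃ r : Fin N → V, (∀ j, r j ≠ 0) ∧ (∀ v : V, v ≠ 0 → ∃ j, ∃ a : F, v = a • r j) ∧
      ∀ i j, ∀ a : F, r i = a • r j → i = j := by
  have : Finite V := Module.finite_of_finite F
  have hcard : Nat.card (Projectivization F V) = N := by
    rw [Projectivization.card'', Module.natCard_eq_pow_finrank (K := F), hV, hN,
      Nat.card_eq_fintype_card]
  let e := (Finite.equivFinOfCardEq hcard).symm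
  refine ⟨fun j => (e j).rep, fun j => (e j).rep_nonzero, fun v hv => ?_, fun i j a h => ?_⟩
  · obtain ⟨a, ha⟩ := (Projectivization.mk_eq_mk_iff' F v (Projectivization.mk F v hv).rep hv
      (Projectivization.rep_nonzero _)).mp (Projectivization.mk_rep _).symm
    exact ⟨e.symm (.mk F v hv), a, by simp [ha]⟩
  · refine e.injective ?_
    rw [← (e i).mk_rep, ← (e j).mk_rep, Projectivization.mk_eq_mk_iff']
    exact ⟨a, h.symm⟩

end HammingCodes

/-- A partial map all of whose fibres over `κ` have `ℓ` elements is, up to a bijection, a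
projection. -/
theorem exists_equiv_of_card_fibers {ι κ : Type*} [Finite ι] {ℓ : ℕ} (P : ι → Option κ)
    (hP : ∀ j, Nat.card {i // P i = some j} = ℓ) :
    ∃ (u : ℕ) (e : ι ≃ (Fin ℓ × κ) ⊕ Fin u),
      (∀ p : Fin ℓ × κ, P (e.symm (Sum.inl p)) = some p.2) ∧
        ∀ b : Fin u, P (e.symm (Sum.inr b)) = none := by
  let E (j : κ) : Fin ℓ ≃ {i // P i = some j} := (Finite.equivFinOfCardEq (hP j)).symm
  let E₀ := (Finite.equivFin {i // P i = none}).symm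
  refine ⟨Nat.card {i // P i = none}, (Equiv.ofBijective (Sum.elim
    (fun p : Fin ℓ × κ => (E p.2 p.1).1) fun b => (E₀ b).1) ⟨?_, fun i => ?_⟩).symm,
    fun p => (E p.2 p.1).2, fun b => (E₀ b).2⟩
  · refine Function.Injective.sumElim ?_ (Subtype.val_injective.comp E₀.injective) ?_
    · rintro ⟨t, j⟩ ⟨t', j'⟩ h
      have hj : some j = some j' := by
        rw [← (E j t).2, ← (E j' t').2]
        exact congrArg P h
      obtain rfl := Option.some_injective _ hj
      exact congrArg (·, j) ((E j).injective (Subtype.ext h))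
    · intro p b h
      have := (E p.2 p.1).2
      rw [h, (E₀ b).2] at this
      cases this
  · cases h : P i with
    | none => exact ⟨Sum.inr (E₀.symm ⟨i, h⟩), by simp⟩
    | some j => exact ⟨Sum.inl ((E j).symm ⟨i, h⟩, j), by simp⟩

section Classification

variable {ι : Type*} [Fintype ι] [DecidableEq ι]

theorem exists_hammingCode_of_card_correctable (C : Submodule F (ι → F)) {m N ℓ : ℕ} (hm : 2 ≤ m)
    (hN : N = (Fintype.card F ^ m - 1) / (Fintype.card F - 1))
    (hrank : Module.finrank F ((ι → F) ⧸ C) = m)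
    (hcard : ∀ x ∉ C, Nat.card {i : ι // ∃ a : F, x - Pi.single i a ∈ C} = ℓ) :
    ∃ u : ℕ, Fintype.card ι = ℓ * N + u ∧ ∃ H : Submodule F (Fin N → F),
      IsHammingCode m H ∧
        MonomiallyEquivalent (C : Set (ι → F)) (hammingRepeatCode ℓ u (H : Set (Fin N → F))) := by
  obtain ⟨r, hr, hspan, hinj⟩ := exists_projective_representatives hN hrank
  have hker (x : ι → F) : C.mkQ x = 0 ↔ x ∈ C := Submodule.Quotient.mk_eq_zero C
  have hcolumn (i : ι) : ∃ (o : Option (Fin N)) (s : Fˣ),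
      C.mkQ (Pi.single i 1) = (s : F) • o.elim 0 r := by
    by_cases hi : C.mkQ (Pi.single i 1) = 0
    · exact ⟨none, 1, by simp [hi]⟩
    · obtain ⟨j, a, h⟩ := hspan _ hi
      refine ⟨some j, Units.mk0 a ?_, h⟩
      rintro rfl
      exact hi (by rw [h, zero_smul])
  choose P s hPs using hcolumn
  have hmkQ (i : ι) (a : F) : C.mkQ (Pi.single i a) = (a * s i) • (P i).elim 0 r := by
    rw [mul_smul, ← hPs, ← map_smul, ← Pi.single_smul, smul_eq_mul, mul_one]
  have hfiber (j : Fin N) : Nat.card {i // P i = some j} = ℓ := by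
    obtain ⟨x, hx⟩ := C.mkQ_surjective (r j)
    have hxC : x ∉ C := fun h => hr j (by rw [← hx]; simpa using h)
    rw [← hcard x hxC]
    refine Nat.card_congr (Equiv.subtypeEquivRight fun i => ?_)
    have hiff (a : F) : x - Pi.single i a ∈ C ↔ r j = (a * s i) • (P i).elim 0 r := by
      rw [← hker, map_sub, sub_eq_zero, hx, hmkQ]
    simp only [hiff]
    constructor
    · intro h
      exact ⟨((s i)⁻¹ : Fˣ), by simp [h]⟩
    · rintro ⟨a, ha⟩
      cases h : P i with
      | none => simp [h, hr j] at ha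
      | some k =>
        rw [h] at ha
        rw [hinj _ _ _ ha]
  obtain ⟨u, e, hinl, hinr⟩ := exists_equiv_of_card_fibers P hfiber
  refine ⟨u, by simpa using Fintype.card_congr e, _,
    isHammingCode_ker_linearCombination hm hN hrank hr hspan hinj, e, s, ?_⟩
  have hmem (x : ι → F) : x ∈ C ↔
      (fun p => (s (e.symm p) : F) * x (e.symm p)) ∈ hammingRepeatCode ℓ u
        ((Fintype.linearCombination F r).ker : Set (Fin N → F)) := by
    have hsum : C.mkQ x = ∑ i, (x i * s i) • (P i).elim 0 r := by
      simp_rw [← hmkQ, ← map_sum]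
      rw [Finset.univ_sum_single]
    rw [← hker, hsum, ← e.symm.sum_comp, Fintype.sum_sum_type,
      Fintype.sum_prod_type_right]
    simp only [hinl, hinr, Option.elim_some, Option.elim_none, smul_zero, Finset.sum_const_zero,
      add_zero, ← Finset.sum_smul, mul_comm (x _)]
    rfl
  ext z
  constructor
  · rintro ⟨x, hx, rfl⟩
    exact (hmem x).mp hx
  · intro hz
    have hx : (fun p => (s (e.symm p) : F) *
        (fun i => ((s i)⁻¹ : Fˣ) * z (e i)) (e.symm p)) = z := by
      ext p
      simp
    exact ⟨fun i => ((s i)⁻¹ : Fˣ) * z (e i), (hmem _).mpr (hx.symm ▸ hz), hx⟩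

omit [Fintype F] [Fintype ι] in
theorem card_correctable_of_monomiallyEquivalent (C : Submodule F (ι → F)) {N ℓ u : ℕ}
    {H : Submodule F (Fin N → F)} (hH : minDist (H : Set (Fin N → F)) = 3)
    (hcov : ∀ x ∉ H, ∃ j, ∃ a : F, x - Pi.single j a ∈ H)
    (heq : MonomiallyEquivalent (C : Set (ι → F)) (hammingRepeatCode ℓ u (H : Set (Fin N → F)))) :
    ∀ x ∉ C, Nat.card {i : ι // ∃ a : F, x - Pi.single i a ∈ C} = ℓ := by
  obtain ⟨e, s, himage⟩ := heq
  let T (x : ι → F) (j : Fin N) : F :=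
    ∑ t : Fin ℓ, (s (e.symm (Sum.inl (t, j))) : F) * x (e.symm (Sum.inl (t, j)))
  have hmem (x : ι → F) : x ∈ C ↔ T x ∈ H := by
    change _ ↔ (fun p => (s (e.symm p) : F) * x (e.symm p)) ∈
      hammingRepeatCode ℓ u (H : Set (Fin N → F))
    rw [← himage]
    refine ⟨fun h => ⟨x, h, rfl⟩, ?_⟩
    rintro ⟨y, hy, hyx⟩
    have : y = x := by
      ext i
      simpa using congrFun hyx (e i)
    exact this ▸ hy
  have hinl (x : ι → F) (t : Fin ℓ) (j : Fin N) (a : F) :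
      T (x - Pi.single (e.symm (Sum.inl (t, j))) a) =
        T x - Pi.single j (s (e.symm (Sum.inl (t, j))) * a) := by
    ext k
    by_cases hk : k = j
    · subst hk
      simp [T, mul_sub, Finset.sum_sub_distrib, Pi.single_apply]
    · simp [T, hk]
  have hinr (x : ι → F) (b : Fin u) (a : F) : T (x - Pi.single (e.symm (Sum.inr b)) a) = T x := by
    ext k
    simp [T]
  intro x hx
  have hTx : T x ∉ H := mt (hmem x).mpr hx
  obtain ⟨j, a, hja⟩ := hcov _ hTx
  have ha : Pi.single j a ≠ (0 : Fin N → F) := fun h => hTx (by simpa [h] using hja)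
  have hcorrect (i : ι) : (∃ b : F, x - Pi.single i b ∈ C) ↔ ∃ t, e.symm (Sum.inl (t, j)) = i := by
    obtain ⟨p, rfl⟩ := e.symm.surjective i
    simp only [hmem, e.symm.injective.eq_iff]
    obtain ⟨t, k⟩ | b := p
    · simp only [hinl, Sum.inl.injEq, Prod.mk.injEq, exists_eq_left]
      constructor
      · rintro ⟨b, hb⟩
        have h := single_eq_single_of_minDist_eq_three hH hja hb
        by_contra hjk
        have := congrFun h j
        rw [Pi.single_eq_same, Pi.single_eq_of_ne hjk] at this
        simp [this] at ha
      · rintro rfl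
        exact ⟨((s (e.symm (Sum.inl (t, j))))⁻¹ : Fˣ) * a, by simpa using hja⟩
    · simp [hinr, hTx]
  rw [Nat.card_congr (Equiv.subtypeEquivRight hcorrect)]
  have hinjective : Function.Injective fun t : Fin ℓ => e.symm (Sum.inl (t, j)) := fun t t' h => by
    simpa using h
  exact (Nat.card_congr (Equiv.ofInjective _ hinjective)).symm.trans (Nat.card_fin ℓ)

end Classification

/-- classification of nontrivial linear completely regular codes with covering
radius 1: they are exactly the codes monomially equivalent to
`{(x₁|⋯|x_ℓ|y) : x₁+⋯+x_ℓ ∈ ℋ, y free}` for a Hamming code `ℋ`. -/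
theorem classification_completely_regular_rho_one
    {F : Type*} [Field F] [Fintype F] [DecidableEq F] {n k d : ℕ}
    (C : Submodule F (Fin n → F))
    (hk : Module.finrank F C = k)
    (hd : minDist (C : Set (Fin n → F)) = d)
    (hk2 : 2 ≤ k) (hkn : k + 2 ≤ n) :
    (IsCompletelyRegular (C : Set (Fin n → F)) ∧
        coveringRadius (C : Set (Fin n → F)) = 1) ↔
      ∃ m : ℕ, 2 ≤ m ∧ ∃ ℓ : ℕ, 1 ≤ ℓ ∧ ∃ u : ℕ,
        n = ℓ * ((Fintype.card F ^ m - 1) / (Fintype.card F - 1)) + u ∧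
        k = n - m ∧
        ∃ H : Submodule F (Fin ((Fintype.card F ^ m - 1) / (Fintype.card F - 1)) → F),
          IsHammingCode m H ∧
          MonomiallyEquivalent (C : Set (Fin n → F))
            (hammingRepeatCode ℓ u
              (H : Set (Fin ((Fintype.card F ^ m - 1) / (Fintype.card F - 1)) → F))) := by
  constructor
  · intro h
    obtain ⟨-, ℓ, hℓ, hcard⟩ := (completelyRegular_coveringRadius_one_iff C).mp h
    have hrank := C.finrank_quotient_add_finrank
    rw [hk, Module.finrank_fin_fun] at hrank
    generalize hm : Module.finrank F ((Fin n → F) ⧸ C) = m at hrank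
    obtain ⟨u, hn, H, hH, heq⟩ := exists_hammingCode_of_card_correctable C (by omega) rfl hm hcard
    rw [Fintype.card_fin] at hn
    exact ⟨m, by omega, ℓ, hℓ, u, hn, by omega, H, hH, heq⟩
  · rintro ⟨m, hm, ℓ, hℓ, u, hn, hkm, H, ⟨-, -, -, hH3, hH1⟩, heq⟩
    refine (completelyRegular_coveringRadius_one_iff C).mpr ⟨?_, ℓ, hℓ,
      card_correctable_of_monomiallyEquivalent C hH3 ((coveringRadius_eq_one_iff H).mp hH1).2 heq⟩
    rintro rfl
    rw [finrank_top, Module.finrank_fin_fun] at hk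
    omega
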